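/- With η, A, B, W_{A,B} as above, the Fourier transform satisfies the bound |(1/A) Ŵ_{A,B}(u/A)| ≪ min(1/|u|, (|B|/A)/(1 + u²)) uniformly in u ≠ 0, A > 0, B ≠ 0. -/

import Mathlib

noncomputable def e (z : ℝ) : ℂ := Complex.exp (2 * Real.pi * Complex.I * z)

/-- The weight function `W_{A,B}(x)`. -/
noncomputable def W (η : ℝ → ℝ) (A B x : ℝ) : ℂ :=
  ∫ t in Set.Ioi (0 : ℝ),
    ((t ^ (-2 : ℤ) * η (|x| * t / A) * Real.exp (-1 / t) : ℝ) : ℂ) * e (-(|x| * t / B))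

/-- The Fourier transform `Ŵ(u) = ∫ W(x) e(-ux) dx`. -/
noncomputable def What (η : ℝ → ℝ) (A B u : ℝ) : ℂ := ∫ x : ℝ, W η A B x * e (-(x * u))

open MeasureTheory Set Filter Topology

lemma aux_tendsto (r : ℝ) (hr : 0 < r) : Tendsto (fun v : ℝ => (1 + r * v)⁻¹) atTop (𝓝 0) :=
  tendsto_inv_atTop_zero.comp (tendsto_atTop_add_const_left _ _ (tendsto_id.const_mul_atTop hr))

lemma aux_J2 (r : ℝ) (hr : 0 < r) : IntegrableOn (fun v : ℝ => 1 / (1 + r * v) ^ 2) (Ioi (1/2)) ∧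
    ∫ v in Ioi (1/2 : ℝ), 1 / (1 + r * v) ^ 2 = 1 / (r * (1 + r / 2)) := by
  have hd : ∀ x ∈ Ici (1/2 : ℝ), HasDerivAt (fun v : ℝ => -(1 / r) * (1 + r * v)⁻¹)
      (1 / (1 + r * x) ^ 2) x := by
    intro x hx
    have hx0 : (0:ℝ) < x := lt_of_lt_of_le (by norm_num) hx
    have hp : (1 + r * x) ≠ 0 := by positivity
    have h1 : HasDerivAt (fun v : ℝ => 1 + r * v) r x := by
      simpa using ((hasDerivAt_id x).const_mul r).const_add 1
    convert! (h1.inv hp).const_mul (-(1 / r)) using 1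
    field_simp
  have ht : Tendsto (fun v : ℝ => -(1 / r) * (1 + r * v)⁻¹) atTop (𝓝 0) := by
    simpa using (aux_tendsto r hr).const_mul (-(1 / r))
  have hpos : ∀ x ∈ Ioi (1/2 : ℝ), 0 ≤ 1 / (1 + r * x) ^ 2 := fun x _ => by positivity
  refine ⟨integrableOn_Ioi_deriv_of_nonneg' hd hpos ht, ?_⟩
  rw [integral_Ioi_of_hasDerivAt_of_nonneg' hd hpos ht]
  have : 1 + r * (1 / 2) ≠ 0 := by positivity
  field_simp
  ring

lemma aux_J3 (r : ℝ) (hr : 0 < r) : IntegrableOn (fun v : ℝ => r / (1 + r * v) ^ 3) (Ioi (1/2)) ∧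
    ∫ v in Ioi (1/2 : ℝ), r / (1 + r * v) ^ 3 = 1 / (2 * (1 + r / 2) ^ 2) := by
  have hd : ∀ x ∈ Ici (1/2 : ℝ), HasDerivAt (fun v : ℝ => -(1 / 2) * ((1 + r * v)⁻¹) ^ 2)
      (r / (1 + r * x) ^ 3) x := by
    intro x hx
    have hx0 : (0:ℝ) < x := lt_of_lt_of_le (by norm_num) hx
    have hp : (1 + r * x) ≠ 0 := by positivity
    have h1 : HasDerivAt (fun v : ℝ => 1 + r * v) r x := by
      simpa using ((hasDerivAt_id x).const_mul r).const_add 1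
    convert! ((h1.inv hp).pow 2).const_mul (-(1 / 2)) using 1
    simp
    field_simp
  have ht : Tendsto (fun v : ℝ => -(1 / 2) * ((1 + r * v)⁻¹) ^ 2) atTop (𝓝 0) := by
    have h := ((aux_tendsto r hr).pow 2).const_mul (-(1 / 2))
    rwa [zero_pow two_ne_zero, mul_zero] at h
  have hpos : ∀ x ∈ Ioi (1/2 : ℝ), 0 ≤ r / (1 + r * x) ^ 3 := fun x hx => by
    have hx0 : (0:ℝ) < x := lt_trans (by norm_num) hx
    positivity
  refine ⟨integrableOn_Ioi_deriv_of_nonneg' hd hpos ht, ?_⟩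
  rw [integral_Ioi_of_hasDerivAt_of_nonneg' hd hpos ht]
  have : 1 + r * (1 / 2) ≠ 0 := by positivity
  field_simp
  ring

lemma norm_e (x : ℝ) : ‖e x‖ = 1 := by
  unfold e
  rw [show (2 * Real.pi * Complex.I * x : ℂ) = ((2 * Real.pi * x : ℝ) : ℂ) * Complex.I by
    push_cast; ring]
  exact Complex.norm_exp_ofReal_mul_I _

lemma continuous_e : Continuous e := by
  unfold e
  fun_prop

lemma norm_lower (c : ℂ) (hc : 0 ≤ c.re) (v : ℝ) (hv : 0 < v) :
    (1 + ‖c‖ * v) / Real.sqrt 2 ≤ ‖1 + c * v‖ := by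
  rw [div_le_iff₀ (by positivity)]
  apply le_of_sq_le_sq _ (by positivity)
  rw [mul_pow, Real.sq_sqrt (by norm_num)]
  have h1 : ‖1 + c * v‖ ^ 2 = (1 + c.re * v) ^ 2 + (c.im * v) ^ 2 := by
    rw [← Complex.normSq_eq_norm_sq, Complex.normSq_apply]; simp; ring
  have h2 : ‖c‖ ^ 2 = c.re ^ 2 + c.im ^ 2 := by
    rw [← Complex.normSq_eq_norm_sq, Complex.normSq_apply]; ring
  have h3 : (‖c‖ * v) ^ 2 = (c.re ^ 2 + c.im ^ 2) * v ^ 2 := by rw [mul_pow, h2]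
  have : 0 ≤ c.re * v := by positivity
  nlinarith [sq_nonneg (1 - ‖c‖ * v)]

lemma norm_lower2 (c : ℂ) (hc : 0 ≤ c.re) (v : ℝ) (hv : 0 < v) :
    1 / ‖1 + c * v‖ ^ 2 ≤ 2 * (1 / (1 + ‖c‖ * v) ^ 2) := by
  have h := norm_lower c hc v hv
  have h0 : 0 < 1 + ‖c‖ * v := by positivity
  have h2 := pow_le_pow_left₀ (by positivity) h 2
  rw [div_pow, Real.sq_sqrt (by norm_num)] at h2
  calc 1 / ‖1 + c * v‖ ^ 2 ≤ 1 / ((1 + ‖c‖ * v) ^ 2 / 2) :=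
        one_div_le_one_div_of_le (by positivity) h2
    _ = _ := by field_simp

lemma norm_lower3 (c : ℂ) (hc : 0 ≤ c.re) (v : ℝ) (hv : 0 < v) :
    1 / ‖1 + c * v‖ ^ 3 ≤ 4 * (1 / (1 + ‖c‖ * v) ^ 3) := by
  have h := norm_lower c hc v hv
  have h0 : 0 < 1 + ‖c‖ * v := by positivity
  have h2 := pow_le_pow_left₀ (by positivity) h 3
  have hs : Real.sqrt 2 ^ 3 ≤ 4 := by
    have : Real.sqrt 2 ^ 2 = 2 := Real.sq_sqrt (by norm_num)
    have h4 : Real.sqrt 2 ≤ 2 := by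
      rw [Real.sqrt_le_left (by norm_num)]; norm_num
    nlinarith
  have h5 : (1 + ‖c‖ * v) ^ 3 / 4 ≤ ‖1 + c * v‖ ^ 3 := by
    refine le_trans ?_ h2
    rw [div_pow]
    gcongr
  calc 1 / ‖1 + c * v‖ ^ 3 ≤ 1 / ((1 + ‖c‖ * v) ^ 3 / 4) :=
        one_div_le_one_div_of_le (by positivity) h5
    _ = _ := by field_simp

lemma integrable_yexp (ε : ℝ) (hε : 0 < ε) :
    IntegrableOn (fun y : ℝ => y * Real.exp (-(ε * y))) (Ioi 0) := by
  have h2 := integrableOn_rpow_mul_exp_neg_mul_rpow (p := 1) (s := 1) (b := ε) (by norm_num) (by norm_num) hε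
  simpa [neg_mul] using h2

lemma norm_exp_neg_mul (z : ℂ) (y : ℝ) : ‖Complex.exp (-(z * y))‖ = Real.exp (-(z.re * y)) := by
  rw [Complex.norm_exp]; simp

lemma laplace (z : ℂ) (hz : 0 < z.re) :
    ∫ y in Ioi (0:ℝ), (y : ℂ) * Complex.exp (-(z * y)) = 1 / z ^ 2 := by
  have hz0 : z ≠ 0 := by rintro rfl; simp at hz
  have hd : ∀ x ∈ Ici (0:ℝ), HasDerivAt
      (fun y : ℝ => -((1 / z) * (y * Complex.exp (-(z * y))) + 1 / z ^ 2 * Complex.exp (-(z * y))))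
      ((x : ℂ) * Complex.exp (-(z * x))) x := by
    intro x _
    have h1 : HasDerivAt (fun y : ℝ => (y : ℂ)) 1 x := Complex.ofRealCLM.hasDerivAt (x := x)
    have h2 : HasDerivAt (fun y : ℝ => Complex.exp (-(z * y))) (Complex.exp (-(z * x)) * (-z)) x := by
      apply HasDerivAt.cexp
      convert! (h1.const_mul z).neg using 1
      simp
    convert! (((h1.mul h2).const_mul (1 / z)).add (h2.const_mul (1 / z ^ 2))).neg using 1
    field_simp
    ring
  have hi : IntegrableOn (fun x : ℝ => (x : ℂ) * Complex.exp (-(z * x))) (Ioi 0) := by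
    refine (integrable_yexp z.re hz).mono' (by fun_prop) ?_
    filter_upwards [ae_restrict_mem measurableSet_Ioi] with y hy
    rw [norm_mul, norm_exp_neg_mul, Complex.norm_real, Real.norm_eq_abs, abs_of_pos hy]
  have ht1 : Tendsto (fun y : ℝ => (y : ℂ) * Complex.exp (-(z * y))) atTop (𝓝 0) := by
    have h := tendsto_rpow_mul_exp_neg_mul_atTop_nhds_zero 1 z.re hz
    refine squeeze_zero_norm' ?_ h
    filter_upwards [eventually_gt_atTop 0] with y hy
    rw [norm_mul, norm_exp_neg_mul, Complex.norm_real, Real.norm_eq_abs, abs_of_pos hy]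
    simp
  have ht0 : Tendsto (fun y : ℝ => Complex.exp (-(z * y))) atTop (𝓝 0) := by
    have h := tendsto_rpow_mul_exp_neg_mul_atTop_nhds_zero 0 z.re hz
    refine squeeze_zero_norm' ?_ h
    filter_upwards [eventually_gt_atTop 0] with y hy
    rw [norm_exp_neg_mul]
    simp
  have ht := ((ht1.const_mul (1 / z)).add (ht0.const_mul (1 / z ^ 2))).neg
  rw [mul_zero, mul_zero, add_zero, neg_zero] at ht
  rw [integral_Ioi_of_hasDerivAt_of_tendsto' hd hi ht]
  simp

lemma deriv_eta_zero (η : ℝ → ℝ) (hone : ∀ t : ℝ, 1 ≤ t → η t = 1)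
    (hzero : ∀ t : ℝ, t ≤ 1 / 2 → η t = 0) (v : ℝ) (hv : v ∉ Icc (1/2 : ℝ) 1) : deriv η v = 0 := by
  by_cases h : v < 1/2
  · have : η =ᶠ[𝓝 v] fun _ => (0:ℝ) := by
      filter_upwards [Iio_mem_nhds h] with x hx
      exact hzero x hx.le
    rw [this.deriv_eq]; simp
  · have h2 : 1 < v := by
      by_contra h3
      exact hv ⟨not_lt.mp h, not_lt.mp h3⟩
    have : η =ᶠ[𝓝 v] fun _ => (1:ℝ) := by
      filter_upwards [Ioi_mem_nhds h2] with x hx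
      exact hone x (le_of_lt hx)
    rw [this.deriv_eq]; simp

lemma deriv_eta_int (η : ℝ → ℝ) (hsm : ContDiff ℝ (⊤ : ℕ∞) η) (hone : ∀ t : ℝ, 1 ≤ t → η t = 1)
    (hzero : ∀ t : ℝ, t ≤ 1 / 2 → η t = 0) : Integrable (deriv η) := by
  refine (hsm.continuous_deriv (by simp)).integrable_of_hasCompactSupport ?_
  exact HasCompactSupport.intro isCompact_Icc (deriv_eta_zero η hone hzero)

lemma one_add_ne (c : ℂ) (hc : 0 ≤ c.re) (v : ℝ) (hv : 0 < v) : (1 + c * v : ℂ) ≠ 0 := by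
  intro h
  have := congrArg Complex.re h
  simp at this
  have : 0 ≤ c.re * v := by positivity
  linarith

lemma integrand_int (η : ℝ → ℝ) (hsm : ContDiff ℝ (⊤ : ℕ∞) η)
    (hrange : ∀ t, η t ∈ Set.Icc (0 : ℝ) 1) (b : ℝ) (c : ℂ) (hc : 0 ≤ c.re) (hc0 : c ≠ 0) :
    IntegrableOn (fun v : ℝ => (η v : ℂ) * (1 / (1 + c * v) ^ 2) * e (-(b * v))) (Ioi (1/2)) ∧
    ‖∫ v in Ioi (1/2 : ℝ), (η v : ℂ) * (1 / (1 + c * v) ^ 2) * e (-(b * v))‖ ≤ 2 / ‖c‖ := by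
  have hr : 0 < ‖c‖ := norm_pos_iff.mpr hc0
  obtain ⟨hi, hI⟩ := aux_J2 ‖c‖ hr
  have hb : ∀ᵐ v ∂(volume.restrict (Ioi (1/2 : ℝ))),
      ‖(η v : ℂ) * (1 / (1 + c * v) ^ 2) * e (-(b * v))‖ ≤ 2 * (1 / (1 + ‖c‖ * v) ^ 2) := by
    filter_upwards [ae_restrict_mem measurableSet_Ioi] with v hv
    have hv0 : (0:ℝ) < v := lt_trans (by norm_num) hv
    rw [norm_mul, norm_mul, norm_e, mul_one, norm_div, norm_pow, norm_one, Complex.norm_real,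
      Real.norm_eq_abs, abs_of_nonneg (hrange v).1]
    refine le_trans ?_ (norm_lower2 c hc v hv0)
    exact mul_le_of_le_one_left (by positivity) (hrange v).2
  have hm : AEStronglyMeasurable (fun v : ℝ => (η v : ℂ) * (1 / (1 + c * v) ^ 2) * e (-(b * v)))
      (volume.restrict (Ioi (1/2 : ℝ))) := by
    have := hsm.continuous.measurable
    have := continuous_e.measurable
    apply Measurable.aestronglyMeasurable
    fun_prop
  refine ⟨(hi.const_mul 2).mono' hm hb, ?_⟩
  refine (norm_integral_le_of_norm_le (hi.const_mul 2) hb).trans ?_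
  rw [integral_const_mul, hI, mul_one_div]
  gcongr
  nlinarith

lemma kernel_bound (η : ℝ → ℝ) (hsm : ContDiff ℝ (⊤ : ℕ∞) η)
    (hrange : ∀ t, η t ∈ Set.Icc (0 : ℝ) 1)
    (hone : ∀ t : ℝ, 1 ≤ t → η t = 1) (hzero : ∀ t : ℝ, t ≤ 1 / 2 → η t = 0)
    (b : ℝ) (hb0 : b ≠ 0) (c : ℂ) (hc : 0 ≤ c.re) (hc0 : c ≠ 0) :
    ‖∫ v in Ioi (1/2 : ℝ), (η v : ℂ) * (1 / (1 + c * v) ^ 2) * e (-(b * v))‖ ≤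
      (2 * (∫ v, ‖deriv η v‖) + 4) / (1 + ‖c‖ / 2) ^ 2 / |b| := by
  have hr : 0 < ‖c‖ := norm_pos_iff.mpr hc0
  obtain ⟨hi, hI⟩ := aux_J3 ‖c‖ hr
  obtain ⟨hfi, -⟩ := integrand_int η hsm hrange b c hc hc0
  have hdi := deriv_eta_int η hsm hone hzero
  set g : ℝ → ℂ := fun v => ((deriv η v : ℝ) : ℂ) * (1 / (1 + c * v) ^ 2)
    + (η v : ℂ) * (-2 * c / (1 + c * v) ^ 3) with hg
  set bd : ℝ → ℝ := fun v => 2 / (1 + ‖c‖ / 2) ^ 2 * ‖deriv η v‖ + 8 * (‖c‖ / (1 + ‖c‖ * v) ^ 3)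
    with hbd
  have hbdi : IntegrableOn bd (Ioi (1/2)) :=
    (hdi.norm.const_mul _).integrableOn.add (hi.const_mul 8)
  have hgb : ∀ᵐ v ∂(volume.restrict (Ioi (1/2 : ℝ))), ‖g v * e (-(b * v))‖ ≤ bd v := by
    filter_upwards [ae_restrict_mem measurableSet_Ioi] with v hv
    have hv0 : (0:ℝ) < v := lt_trans (by norm_num) hv
    have hv1 : (1/2:ℝ) < v := hv
    rw [norm_mul, norm_e, mul_one]
    refine (norm_add_le _ _).trans ?_
    apply add_le_add
    · rw [norm_mul, norm_div, norm_pow, norm_one, Complex.norm_real, mul_comm]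
      refine mul_le_mul_of_nonneg_right ?_ (norm_nonneg _)
      refine (norm_lower2 c hc v hv0).trans ?_
      rw [mul_one_div]
      gcongr
      nlinarith
    · rw [norm_mul, norm_div, norm_pow, norm_mul, Complex.norm_real, norm_neg,
        Real.norm_eq_abs, abs_of_nonneg (hrange v).1]
      refine (mul_le_of_le_one_left (by positivity) (hrange v).2).trans ?_
      have := mul_le_mul_of_nonneg_left (norm_lower3 c hc v hv0) (by positivity : 0 ≤ 2 * ‖c‖)
      calc ‖(2:ℂ)‖ * ‖c‖ / ‖1 + c * v‖ ^ 3 = 2 * ‖c‖ * (1 / ‖1 + c * v‖ ^ 3) := by simp; ring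
        _ ≤ _ := this
        _ = _ := by ring
  have hm : AEStronglyMeasurable (fun v : ℝ => g v * e (-(b * v)))
      (volume.restrict (Ioi (1/2 : ℝ))) := by
    have := hsm.continuous.measurable
    have := (hsm.continuous_deriv (by simp)).measurable
    have := continuous_e.measurable
    apply Measurable.aestronglyMeasurable
    fun_prop
  have hgi : IntegrableOn (fun v : ℝ => g v * e (-(b * v))) (Ioi (1/2)) := hbdi.mono' hm hgb
  have hgbound : ‖∫ v in Ioi (1/2 : ℝ), g v * e (-(b * v))‖ ≤
      (2 * (∫ v, ‖deriv η v‖) + 4) / (1 + ‖c‖ / 2) ^ 2 := by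
    refine (norm_integral_le_of_norm_le hbdi hgb).trans ?_
    rw [hbd, integral_add (hdi.norm.const_mul _).integrableOn (hi.const_mul 8),
      integral_const_mul, integral_const_mul, hI]
    have h1 : ∫ v in Ioi (1/2 : ℝ), ‖deriv η v‖ ≤ ∫ v, ‖deriv η v‖ :=
      setIntegral_le_integral hdi.norm (Eventually.of_forall fun v => norm_nonneg _)
    have h2 := mul_le_mul_of_nonneg_left h1 (by positivity : 0 ≤ 2 / (1 + ‖c‖ / 2) ^ 2)
    refine (add_le_add_left h2 _).trans (le_of_eq ?_)
    field_simp
    ring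
  have hder : ∀ x ∈ Ici (1/2 : ℝ), HasDerivAt
      (fun v : ℝ => (η v : ℂ) * (1 / (1 + c * v) ^ 2) * e (-(b * v)))
      (g x * e (-(b * x)) + (-(2 * Real.pi * Complex.I * b)) *
        ((η x : ℂ) * (1 / (1 + c * x) ^ 2) * e (-(b * x)))) x := by
    intro x hx
    have hx0 : (0:ℝ) < x := lt_of_lt_of_le (by norm_num) hx
    have hne := one_add_ne c hc x hx0
    have h1 : HasDerivAt (fun v : ℝ => (η v : ℂ)) ((deriv η x : ℝ) : ℂ) x :=
      ((hsm.differentiable (by simp)) x).hasDerivAt.ofReal_comp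
    have h2 : HasDerivAt (fun v : ℝ => (1 + c * v : ℂ)) c x := by
      simpa using ((Complex.ofRealCLM.hasDerivAt (x := x)).const_mul c).const_add 1
    have h3 : HasDerivAt (fun v : ℝ => (1 / (1 + c * v) ^ 2 : ℂ)) (-2 * c / (1 + c * x) ^ 3) x := by
      convert! (h2.pow 2).inv (pow_ne_zero 2 hne) using 1
      · funext v; simp
      · simp; field_simp
    have h4 : HasDerivAt (fun v : ℝ => e (-(b * v)))
        (e (-(b * x)) * (-(2 * Real.pi * Complex.I * b))) x := by
      unfold e
      apply HasDerivAt.cexp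
      have := (Complex.ofRealCLM.hasDerivAt (x := x)).const_mul (-(2 * Real.pi * Complex.I * b))
      convert! this using 1
      · funext v; simp; ring
      · simp
    convert! (h1.mul h3).mul h4 using 1
    simp only [hg, Pi.mul_apply]
    ring
  have hlim : Tendsto (fun v : ℝ => (η v : ℂ) * (1 / (1 + c * v) ^ 2) * e (-(b * v))) atTop (𝓝 0) := by
    have h1 : Tendsto (fun v : ℝ => 2 * ((1 + ‖c‖ * v)⁻¹) ^ 2) atTop (𝓝 0) := by
      simpa using ((aux_tendsto _ hr).pow 2).const_mul 2
    refine squeeze_zero_norm' ?_ h1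
    filter_upwards [eventually_gt_atTop 0] with v hv0
    rw [norm_mul, norm_mul, norm_e, mul_one, norm_div, norm_pow, norm_one, Complex.norm_real,
      Real.norm_eq_abs, abs_of_nonneg (hrange v).1]
    refine (mul_le_of_le_one_left (by positivity) (hrange v).2).trans ?_
    refine (norm_lower2 c hc v hv0).trans (le_of_eq ?_)
    simp
  have hFTC := integral_Ioi_of_hasDerivAt_of_tendsto' hder (hgi.add (hfi.const_mul _)) hlim
  rw [integral_add hgi (hfi.const_mul _), integral_const_mul, hzero _ le_rfl] at hFTC
  simp only [Complex.ofReal_zero, zero_mul, sub_zero] at hFTC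
  have hEq := eq_neg_of_add_eq_zero_left hFTC
  rw [hEq, norm_neg, norm_mul, norm_neg] at hgbound
  rw [le_div_iff₀ (abs_pos.mpr hb0)]
  refine le_trans ?_ hgbound
  have : ‖(2 * Real.pi * Complex.I * b : ℂ)‖ = 2 * Real.pi * |b| := by
    simp [abs_of_pos Real.pi_pos]
  rw [this, mul_comm]
  gcongr
  nlinarith [Real.pi_gt_three, abs_nonneg b]

lemma W_even (η : ℝ → ℝ) (A B x : ℝ) : W η A B (-x) = W η A B x := by
  simp [W]

lemma W_formula (η : ℝ → ℝ) (hzero : ∀ t : ℝ, t ≤ 1 / 2 → η t = 0) (A B y : ℝ) (hA : 0 < A)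
    (hB : B ≠ 0) (hy : 0 < y) :
    W η A B (A * y) = ∫ v in Ioi (1/2 : ℝ),
      ((y * (1 / v ^ 2) * η v * Real.exp (-(y / v)) : ℝ) : ℂ) * e (-(A / B * v)) := by
  have h1 : ∫ v in Ioi (1/2 : ℝ),
      ((y * (1 / v ^ 2) * η v * Real.exp (-(y / v)) : ℝ) : ℂ) * e (-(A / B * v)) =
      ∫ v in Ioi (0 : ℝ),
      ((y * (1 / v ^ 2) * η v * Real.exp (-(y / v)) : ℝ) : ℂ) * e (-(A / B * v)) := by
    refine setIntegral_eq_of_subset_of_forall_sdiff_eq_zero measurableSet_Ioi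
      (Ioi_subset_Ioi (by norm_num)) ?_ |>.symm
    intro v hv
    have : η v = 0 := hzero v (not_lt.mp hv.2)
    simp [this]
  have h2 := integral_comp_mul_left_Ioi' (fun v : ℝ =>
    ((y * (1 / v ^ 2) * η v * Real.exp (-(y / v)) : ℝ) : ℂ) * e (-(A / B * v))) 0 hy
  rw [mul_zero] at h2
  rw [h1, ← h2, W, ← integral_smul]
  refine setIntegral_congr_fun measurableSet_Ioi fun t ht => ?_
  have ht0 : (0:ℝ) < t := ht
  have hAy : |A * y| = A * y := abs_of_pos (by positivity)
  simp only [hAy]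
  rw [show A * y * t / A = y * t by field_simp, show A * y * t / B = A / B * (y * t) by ring,
    show -1 / t = -(y / (y * t)) by field_simp, Complex.real_smul, ← mul_assoc (y : ℂ),
    ← Complex.ofReal_mul]
  congr 2
  rw [zpow_neg]
  have : (t ^ (2:ℤ)) = t ^ 2 := by norm_cast
  rw [this]
  field_simp

lemma regularized (η : ℝ → ℝ) (hsm : ContDiff ℝ (⊤ : ℕ∞) η)
    (hrange : ∀ t, η t ∈ Set.Icc (0 : ℝ) 1) (hzero : ∀ t : ℝ, t ≤ 1 / 2 → η t = 0)
    (A B u ε : ℝ) (hA : 0 < A) (hB : B ≠ 0) (hε : 0 < ε) :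
    ∫ y in Ioi (0:ℝ), (Real.exp (-(ε * y)) : ℂ) * (W η A B (A * y) * e (-(y * u))) =
    ∫ v in Ioi (1/2 : ℝ), (η v : ℂ) * (1 / (1 + (ε + 2 * Real.pi * u * Complex.I) * v) ^ 2)
      * e (-(A / B * v)) := by
  set F : ℝ → ℝ → ℂ := fun y v => (Real.exp (-(ε * y)) : ℂ) * (((y * (1 / v ^ 2) * η v *
    Real.exp (-(y / v)) : ℝ) : ℂ) * e (-(A / B * v)) * e (-(y * u))) with hF
  have hv2 : IntegrableOn (fun v : ℝ => 1 / v ^ 2) (Ioi (1/2)) := by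
    have := integrableOn_Ioi_rpow_of_lt (a := -2) (c := 1/2) (by norm_num) (by norm_num)
    refine this.congr_fun (fun v hv => ?_) measurableSet_Ioi
    have hv0 : (0:ℝ) < v := lt_trans (by norm_num) hv
    simp only
    rw [Real.rpow_neg hv0.le]; simp
  have hFi : Integrable (Function.uncurry F)
      ((volume.restrict (Ioi (0:ℝ))).prod (volume.restrict (Ioi (1/2 : ℝ)))) := by
    refine ((integrable_yexp ε hε).mul_prod hv2).mono' ?_ ?_
    · have := hsm.continuous.measurable
      have := continuous_e.measurable
      apply Measurable.aestronglyMeasurable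
      simp only [hF, Function.uncurry_def]
      fun_prop
    · rw [Measure.prod_restrict]
      filter_upwards [ae_restrict_mem (measurableSet_Ioi.prod measurableSet_Ioi)] with p hp
      obtain ⟨y, v⟩ := p
      have hy0 : (0:ℝ) < y := hp.1
      have hv0 : (0:ℝ) < v := lt_trans (by norm_num) hp.2
      simp only [hF, Function.uncurry_apply_pair]
      rw [norm_mul, norm_mul, norm_mul, norm_e, norm_e, mul_one, mul_one, Complex.norm_real,
        Complex.norm_real, Real.norm_eq_abs, Real.norm_eq_abs, abs_of_pos (Real.exp_pos _),
        abs_of_nonneg (by have := (hrange v).1; positivity)]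
      have h1 : Real.exp (-(y / v)) ≤ 1 := Real.exp_le_one_iff.mpr (by
        have : 0 < y / v := by positivity
        linarith)
      have h2 : η v * Real.exp (-(y / v)) ≤ 1 :=
        mul_le_one₀ (hrange v).2 (Real.exp_pos _).le h1
      calc Real.exp (-(ε * y)) * (y * (1 / v ^ 2) * η v * Real.exp (-(y / v)))
          = (y * Real.exp (-(ε * y)) * (1 / v ^ 2)) * (η v * Real.exp (-(y / v))) := by ring
        _ ≤ _ := mul_le_of_le_one_right (by positivity) h2
  have hL : ∫ y in Ioi (0:ℝ), (Real.exp (-(ε * y)) : ℂ) * (W η A B (A * y) * e (-(y * u))) =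
      ∫ y in Ioi (0:ℝ), ∫ v in Ioi (1/2 : ℝ), F y v := by
    refine setIntegral_congr_fun measurableSet_Ioi fun y hy => ?_
    simp only [hF]
    rw [integral_const_mul, integral_mul_const, W_formula η hzero A B y hA hB hy]
  rw [hL, integral_integral_swap hFi]
  refine setIntegral_congr_fun measurableSet_Ioi fun v hv => ?_
  have hv0 : (0:ℝ) < v := lt_trans (by norm_num) hv
  set z : ℂ := 1 / v + (ε + 2 * Real.pi * u * Complex.I) with hz
  have hzre : z.re = 1 / v + ε := by
    have : z = ((1 / v + ε : ℝ) : ℂ) + ((2 * Real.pi * u : ℝ) : ℂ) * Complex.I := by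
      rw [hz]; push_cast; ring
    rw [this]; simp
  have hzp : 0 < z.re := by rw [hzre]; positivity
  have hEq : ∀ y : ℝ, F y v = ((1 / v ^ 2 * η v : ℝ) : ℂ) * e (-(A / B * v)) *
      ((y : ℂ) * Complex.exp (-(z * y))) := by
    intro y
    have : Complex.exp (-(z * y)) = (Real.exp (-(ε * y)) : ℂ) * (Real.exp (-(y / v)) : ℂ)
        * e (-(y * u)) := by
      rw [e, Complex.ofReal_exp, Complex.ofReal_exp, ← Complex.exp_add, ← Complex.exp_add, hz]
      congr 1
      push_cast
      ring
    rw [this, hF]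
    push_cast
    ring
  simp only [hEq]
  rw [integral_const_mul, laplace z hzp]
  have hvc : (v : ℂ) ≠ 0 := by exact_mod_cast hv0.ne'
  have hzv : (1 + (ε + 2 * Real.pi * u * Complex.I) * v : ℂ) = z * v := by
    rw [hz]; field_simp
  rw [hzv]
  push_cast
  rw [mul_pow]
  field_simp

lemma half_bound (η : ℝ → ℝ) (hsm : ContDiff ℝ (⊤ : ℕ∞) η)
    (hrange : ∀ t, η t ∈ Set.Icc (0 : ℝ) 1)
    (hone : ∀ t : ℝ, 1 ≤ t → η t = 1) (hzero : ∀ t : ℝ, t ≤ 1 / 2 → η t = 0)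
    (A B u : ℝ) (hA : 0 < A) (hB : B ≠ 0) (hu : u ≠ 0)
    (hint : IntegrableOn (fun y => W η A B (A * y) * e (-(y * u))) (Ioi 0)) :
    ‖∫ y in Ioi (0:ℝ), W η A B (A * y) * e (-(y * u))‖ ≤
      (2 * (∫ v, ‖deriv η v‖) + 4) * min (1 / |u|) ((|B| / A) / (1 + u ^ 2)) := by
  have hL : 0 ≤ ∫ v, ‖deriv η v‖ := integral_nonneg fun v => norm_nonneg _
  have hlim : Tendsto (fun ε : ℝ => ∫ y in Ioi (0:ℝ),
      (Real.exp (-(ε * y)) : ℂ) * (W η A B (A * y) * e (-(y * u)))) (𝓝[>] 0)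
      (𝓝 (∫ y in Ioi (0:ℝ), W η A B (A * y) * e (-(y * u)))) := by
    refine tendsto_integral_filter_of_dominated_convergence
      (fun y => ‖W η A B (A * y) * e (-(y * u))‖) ?_ ?_ hint.norm ?_
    · refine Eventually.of_forall fun ε => ?_
      exact (by fun_prop : Continuous fun y : ℝ =>
        (Real.exp (-(ε * y)) : ℂ)).aestronglyMeasurable.mul hint.aestronglyMeasurable
    · filter_upwards [self_mem_nhdsWithin] with ε hε
      filter_upwards [ae_restrict_mem measurableSet_Ioi] with y hy
      have hε0 : (0:ℝ) < ε := hε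
      have hy0 : (0:ℝ) < y := hy
      rw [norm_mul]
      refine mul_le_of_le_one_left (norm_nonneg _) ?_
      rw [Complex.norm_real, Real.norm_eq_abs, abs_of_pos (Real.exp_pos _), Real.exp_le_one_iff]
      have : 0 < ε * y := by positivity
      linarith
    · refine Eventually.of_forall fun y => ?_
      have : Continuous fun ε : ℝ =>
        (Real.exp (-(ε * y)) : ℂ) * (W η A B (A * y) * e (-(y * u))) := by fun_prop
      have h := this.tendsto 0
      simp only [zero_mul, neg_zero, Real.exp_zero, Complex.ofReal_one, one_mul] at h
      exact h.mono_left nhdsWithin_le_nhds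
  refine le_of_tendsto hlim.norm ?_
  filter_upwards [self_mem_nhdsWithin] with ε hε
  have hε0 : (0:ℝ) < ε := hε
  rw [regularized η hsm hrange hzero A B u ε hA hB hε0]
  set c : ℂ := ε + 2 * Real.pi * u * Complex.I with hc
  have hc' : c = ((ε : ℝ) : ℂ) + ((2 * Real.pi * u : ℝ) : ℂ) * Complex.I := by
    rw [hc]; push_cast; ring
  have hre : c.re = ε := by rw [hc']; simp
  have him : c.im = 2 * Real.pi * u := by rw [hc']; simp
  have hcre : 0 ≤ c.re := by rw [hre]; exact hε0.le
  have hc0 : c ≠ 0 := by intro h; rw [h] at hre; simp at hre; linarith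
  have hu0 : 0 < |u| := abs_pos.mpr hu
  have hnorm : 2 * |u| ≤ ‖c‖ := by
    refine le_trans ?_ (Complex.abs_im_le_norm c)
    rw [him, abs_mul, abs_mul, abs_of_pos Real.pi_pos, abs_of_pos (by norm_num : (0:ℝ) < 2)]
    nlinarith [Real.pi_gt_three]
  rw [mul_min_of_nonneg _ _ (by positivity)]
  refine le_min ?_ ?_
  · refine (integrand_int η hsm hrange (A / B) c hcre hc0).2.trans ?_
    calc 2 / ‖c‖ ≤ 2 / (2 * |u|) := by gcongr
      _ = 1 * (1 / |u|) := by field_simp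
      _ ≤ _ := by gcongr; linarith
  · have hb : A / B ≠ 0 := div_ne_zero hA.ne' hB
    refine (kernel_bound η hsm hrange hone hzero (A / B) hb c hcre hc0).trans ?_
    have h1 : 1 + u ^ 2 ≤ (1 + ‖c‖ / 2) ^ 2 := by
      rw [← sq_abs u]
      nlinarith [norm_nonneg c]
    have hB0 : 0 < |B| := abs_pos.mpr hB
    rw [abs_div, abs_of_pos hA]
    calc (2 * (∫ v, ‖deriv η v‖) + 4) / (1 + ‖c‖ / 2) ^ 2 / (A / |B|)
        ≤ (2 * (∫ v, ‖deriv η v‖) + 4) / (1 + u ^ 2) / (A / |B|) := by gcongr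
      _ = _ := by field_simp

/-- `(1/A) Ŵ_{A,B}(u/A) ≪ min(1/|u|, (|B|/A)/(1+u²))` uniformly in `u ≠ 0`, `A > 0`, `B ≠ 0`. -/
theorem What_bound (η : ℝ → ℝ) (hsm : ContDiff ℝ (⊤ : ℕ∞) η)
    (hrange : ∀ t, η t ∈ Set.Icc (0 : ℝ) 1)
    (hone : ∀ t : ℝ, 1 ≤ t → η t = 1) (hzero : ∀ t : ℝ, t ≤ 1 / 2 → η t = 0) :
    ∃ C : ℝ, 0 < C ∧ ∀ (A B u : ℝ), 0 < A → B ≠ 0 → u ≠ 0 →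
      ‖(1 / (A : ℂ)) * What η A B (u / A)‖
        ≤ C * min (1 / |u|) ((|B| / A) / (1 + u ^ 2)) := by
  have hL : 0 ≤ ∫ v, ‖deriv η v‖ := integral_nonneg fun v => norm_nonneg _
  refine ⟨2 * (2 * (∫ v, ‖deriv η v‖) + 4), by positivity, fun A B u hA hB hu => ?_⟩
  have hscale : (1 / (A : ℂ)) * What η A B (u / A) =
      ∫ y : ℝ, W η A B (A * y) * e (-(y * u)) := by
    have h := Measure.integral_comp_mul_left (fun x : ℝ => W η A B x * e (-(x * (u / A)))) A
    rw [abs_of_pos (inv_pos.mpr hA), Complex.real_smul] at h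
    rw [What, one_div, ← Complex.ofReal_inv, ← h]
    congr 1
    funext y
    rw [show A * y * (u / A) = y * u by field_simp]
  rw [hscale]
  have hmin : 0 ≤ min (1 / |u|) ((|B| / A) / (1 + u ^ 2)) := le_min (by positivity) (by positivity)
  by_cases hint : Integrable (fun y : ℝ => W η A B (A * y) * e (-(y * u)))
  swap
  · rw [integral_undef hint, norm_zero]
    positivity
  have hneg : ∀ y : ℝ, W η A B (A * -y) * e (-(-y * u)) = W η A B (A * y) * e (-(y * -u)) := by
    intro y
    rw [mul_neg, W_even, neg_mul, mul_neg]
  have hint2 : Integrable (fun y : ℝ => W η A B (A * y) * e (-(y * -u))) := by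
    have := hint.comp_neg
    simpa only [hneg] using this
  have hsplit : ∫ y : ℝ, W η A B (A * y) * e (-(y * u)) =
      (∫ y in Ioi (0:ℝ), W η A B (A * y) * e (-(y * -u))) +
      ∫ y in Ioi (0:ℝ), W η A B (A * y) * e (-(y * u)) := by
    have h := integral_comp_neg_Ioi 0 (fun y : ℝ => W η A B (A * y) * e (-(y * u)))
    simp only [hneg, neg_zero] at h
    rw [h, intervalIntegral.integral_Iic_add_Ioi hint.integrableOn hint.integrableOn]
  rw [hsplit]
  have h1 := half_bound η hsm hrange hone hzero A B u hA hB hu hint.integrableOn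
  have h2 := half_bound η hsm hrange hone hzero A B (-u) hA hB (neg_ne_zero.mpr hu) hint2.integrableOn
  rw [abs_neg, neg_sq] at h2
  refine (norm_add_le _ _).trans ?_
  linarith
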